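/- Let r ≥ 1, χ : {1,…,r} → {0,1}, A ∈ GL_r(ℝ), and x, y ∈ (0,1)^r. Then there exists a function G : ℂ^r → ℂ, holomorphic on all of ℂ^r, such that G(s) = L_χ(s, A, x, y) for every s ∈ ℂ^r with Re s_ν > 0 for all ν. In particular, L_χ(s, A, x, y) extends to an entire function of s ∈ ℂ^r. -/

import Mathlib

open MeasureTheory

noncomputable section

/-- `e z = exp (2 π i z)` -/
def eC (z : ℂ) : ℂ := Complex.exp (2 * Real.pi * Complex.I * z)

/-- `φ(t,x,y) = e(itx)/(1 - e(y + it))` -/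
def phiF (t x y : ℝ) : ℂ := eC (Complex.I * t * x) / (1 - eC (y + Complex.I * t))

/-- `F(t,x,y) = ∏_ν φ(t_ν, x_ν, y_ν)` -/
def FF {r : ℕ} (t x y : Fin r → ℝ) : ℂ := ∏ ν, phiF (t ν) (x ν) (y ν)

/-- `Γ_ℝ(s) = π^(-s/2) Γ(s/2)` -/
def GammaR (s : ℂ) : ℂ := (Real.pi : ℂ) ^ (-s / 2) * Complex.Gamma (s / 2)

/-- `Γ_ℂ(s) = 2 (2π)^(-s) Γ(s)` -/
def GammaC (s : ℂ) : ℂ := 2 * (2 * (Real.pi : ℂ)) ^ (-s) * Complex.Gamma s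

/-- the quasi-character `|t|_χ^s = ∏_ν sgn(t_ν)^{χ(ν)} |t_ν|^{s_ν}` -/
def qchar {r : ℕ} (χ : Fin r → ℕ) (s : Fin r → ℂ) (t : Fin r → ℝ) : ℂ :=
  ∏ ν, ((Real.sign (t ν) : ℂ)) ^ (χ ν) * ((|t ν| : ℝ) : ℂ) ^ (s ν)

/-- the Shintani L-function, defined by the integral representation
`L(s,A,x,y) = 2^r (∏ Γ_ℂ(s_ν))⁻¹ ∫_{(0,∞)^r} F(tA,x,y) t^s ∏ dt_ν/t_ν` -/
def ShintaniL {r : ℕ} (s : Fin r → ℂ) (A : Matrix (Fin r) (Fin r) ℝ)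
    (x y : Fin r → ℝ) : ℂ :=
  2 ^ r * (∏ ν, GammaC (s ν))⁻¹ *
    ∫ t in Set.univ.pi fun _ : Fin r => Set.Ioi (0 : ℝ),
      FF (Matrix.vecMul t A) x y * ∏ ν, (((t ν : ℝ) : ℂ) ^ (s ν) * ((t ν : ℝ) : ℂ)⁻¹)

/-- the normalized Shintani L-function of parity type χ,
`L_χ(s,A,x,y) = (∏ Γ_ℂ(s_ν))⁻¹ ∫_{(ℝ^×)^r} F(tA,x,y) |t|_χ^s ∏ dt_ν/t_ν` -/
def ShintaniLchi {r : ℕ} (χ : Fin r → ℕ) (s : Fin r → ℂ)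
    (A : Matrix (Fin r) (Fin r) ℝ) (x y : Fin r → ℝ) : ℂ :=
  (∏ ν, GammaC (s ν))⁻¹ *
    ∫ t : Fin r → ℝ,
      FF (Matrix.vecMul t A) x y * qchar χ s t * ∏ ν, ((t ν : ℝ) : ℂ)⁻¹

/-- `Γ_χ(s) = ∏_ν Γ_ℝ(s_ν + χ(ν))` -/
def GammaChi {r : ℕ} (χ : Fin r → ℕ) (s : Fin r → ℂ) : ℂ :=
  ∏ ν, GammaR (s ν + (χ ν : ℂ))

/-- the completed normalized Shintani L-function
`L̂_χ(s,A,x,y) = |det A|^{1/2} Γ_χ(s) L_χ(s,A,x,y)` -/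
def ShintaniLhat {r : ℕ} (χ : Fin r → ℕ) (s : Fin r → ℂ)
    (A : Matrix (Fin r) (Fin r) ℝ) (x y : Fin r → ℝ) : ℂ :=
  ((Real.sqrt |A.det| : ℝ) : ℂ) * GammaChi χ s * ShintaniLchi χ s A x y



/-- one-dimensional kernel -/
def KK (k : ℕ) (s : ℂ) (u : ℝ) : ℂ :=
  ((Real.sign u : ℂ)) ^ k * ((|u| : ℝ) : ℂ) ^ s * ((u : ℝ) : ℂ)⁻¹

lemma abs_cpow_eq {u : ℝ} (hu : u ≠ 0) (s : ℂ) :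
    ((|u| : ℝ) : ℂ) ^ s = Complex.exp ((Real.log u : ℂ) * s) := by
  have h : ((|u| : ℝ) : ℂ) ≠ 0 := by simpa using hu
  rw [Complex.cpow_def_of_ne_zero h, ← Complex.ofReal_log (abs_nonneg u), Real.log_abs]

lemma norm_sign_pow_le (k : ℕ) (u : ℝ) : ‖((Real.sign u : ℂ)) ^ k‖ ≤ 1 := by
  rw [norm_pow]
  apply pow_le_one₀ (norm_nonneg _)
  rcases Real.sign_apply_eq u with h | h | h <;> simp [h]

lemma KK_zero (k : ℕ) (s : ℂ) : KK k s 0 = 0 := by simp [KK]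

lemma KK_measurable (k : ℕ) (s : ℂ) : Measurable (KK k s) := by
  have hs : Measurable Real.sign := by
    unfold Real.sign
    exact Measurable.ite measurableSet_Iio measurable_const
      (Measurable.ite measurableSet_Ioi measurable_const measurable_const)
  unfold KK
  fun_prop

lemma KK_norm_le (k : ℕ) (s : ℂ) (u : ℝ) : ‖KK k s u‖ ≤ |u| ^ (s.re - 1) := by
  by_cases hu : u = 0
  · subst hu; rw [KK_zero]; simp; positivity
  · have h0 : 0 < |u| := abs_pos.mpr hu
    unfold KK
    rw [norm_mul, norm_mul, Complex.norm_cpow_eq_rpow_re_of_pos h0, Real.rpow_sub h0,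
      Real.rpow_one, norm_inv, Complex.norm_real, Real.norm_eq_abs, div_eq_mul_inv]
    have := norm_sign_pow_le k u
    have h2 : 0 ≤ |u| ^ s.re * |u|⁻¹ := by positivity
    rw [mul_assoc]
    exact mul_le_of_le_one_left h2 this

lemma KK_hasDerivAt_s (k : ℕ) (s : ℂ) (u : ℝ) :
    HasDerivAt (fun s => KK k s u) ((Real.log u : ℂ) * KK k s u) s := by
  by_cases hu : u = 0
  · subst hu; simp only [KK_zero, mul_zero]; exact hasDerivAt_const _ _
  · unfold KK
    simp only [abs_cpow_eq hu]
    have h1 : HasDerivAt (fun s : ℂ => Complex.exp ((Real.log u : ℂ) * s))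
        (Complex.exp ((Real.log u : ℂ) * s) * ((Real.log u : ℂ) * 1)) s :=
      ((hasDerivAt_id s).const_mul _).cexp
    exact ((h1.const_mul (((Real.sign u : ℂ)) ^ k)).mul_const (((u : ℝ) : ℂ)⁻¹)).congr_deriv
      (by ring)

lemma integrable_kernel {c σ : ℝ} (hc : 0 < c) (hσ : 0 < σ) :
    Integrable (fun u : ℝ => |u| ^ (σ - 1) * Real.exp (-c * |u|)) := by
  have h1 : IntegrableOn (fun u : ℝ => |u| ^ (σ - 1) * Real.exp (-c * |u|)) (Set.Ioi 0) := by
    have := integrableOn_rpow_mul_exp_neg_mul_rpow (p := 1) (s := σ - 1) (b := c)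
      (by linarith) one_pos hc
    refine this.congr_fun ?_ measurableSet_Ioi
    intro u hu
    simp only [Real.rpow_one, abs_of_pos (Set.mem_Ioi.mp hu)]
  have h2 : IntegrableOn (fun u : ℝ => |u| ^ (σ - 1) * Real.exp (-c * |u|)) (Set.Iic 0) := by
    have h3 := (integrableOn_Ici_iff_integrableOn_Ioi).mpr h1
    have := h3.comp_neg
    simpa using this
  rw [← integrableOn_univ, ← Set.Iic_union_Ioi (a := (0:ℝ))]
  exact h2.union h1

lemma rpow_le_sum {a p q z : ℝ} (ha : 0 ≤ a) (hz : a = 0 → 0 < z) (h1 : p ≤ z) (h2 : z ≤ q) :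
    a ^ z ≤ a ^ p + a ^ q := by
  rcases ha.eq_or_lt with h | h
  · subst h; rw [Real.zero_rpow (hz rfl).ne']; positivity
  · rcases le_total a 1 with h' | h'
    · have := Real.rpow_le_rpow_of_exponent_ge h h' h1
      have : 0 ≤ a ^ q := by positivity
      linarith
    · have := Real.rpow_le_rpow_of_exponent_le h' h2
      have : 0 ≤ a ^ p := by positivity
      linarith

lemma abs_log_le {a δ : ℝ} (ha : 0 < a) (hδ : 0 < δ) :
    |Real.log a| ≤ (a ^ δ + a ^ (-δ)) / δ := by
  have h1 := Real.log_le_rpow_div ha.le hδ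
  have h2 := Real.log_le_rpow_div (inv_pos.mpr ha).le hδ
  rw [Real.log_inv, Real.inv_rpow ha.le, ← Real.rpow_neg ha.le] at h2
  have h3 : 0 ≤ a ^ δ / δ := by positivity
  have h4 : 0 ≤ a ^ (-δ) / δ := by positivity
  rw [add_div, abs_le]; constructor <;> linarith

/-- dominating function -/
def BB (σ δ : ℝ) (u : ℝ) : ℝ := |u| ^ (σ - 2 * δ - 1) + |u| ^ (σ + 2 * δ - 1)

lemma BB_nonneg (σ δ u : ℝ) : 0 ≤ BB σ δ u := by unfold BB; positivity

lemma KK_le_BB (k : ℕ) {s : ℂ} {σ δ : ℝ} (hδ : 0 < δ) (h : |s.re - σ| ≤ δ) (u : ℝ) :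
    ‖KK k s u‖ ≤ BB σ δ u := by
  by_cases hu : u = 0
  · subst hu; rw [KK_zero, norm_zero]; exact BB_nonneg _ _ _
  · refine (KK_norm_le k s u).trans ?_
    rw [abs_le] at h
    exact rpow_le_sum (abs_nonneg u) (fun h => absurd (abs_eq_zero.mp h) hu)
      (by linarith) (by linarith)

lemma logKK_le_BB (k : ℕ) {s : ℂ} {σ δ : ℝ} (hδ : 0 < δ) (h : |s.re - σ| ≤ δ) (u : ℝ) :
    ‖(Real.log u : ℂ) * KK k s u‖ ≤ 2 / δ * BB σ δ u := by
  by_cases hu : u = 0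
  · subst hu; rw [KK_zero, mul_zero, norm_zero]
    have := BB_nonneg σ δ 0
    positivity
  · have h0 : 0 < |u| := abs_pos.mpr hu
    rw [abs_le] at h
    have h1 := abs_log_le h0 hδ
    have h2 := KK_norm_le k s u
    rw [norm_mul, Complex.norm_real, Real.norm_eq_abs, ← Real.log_abs u]
    have h3 : |u| ^ δ * |u| ^ (s.re - 1) ≤ BB σ δ u := by
      rw [← Real.rpow_add h0]
      exact rpow_le_sum (abs_nonneg u) (fun h => absurd (abs_eq_zero.mp h) hu)
        (by linarith) (by linarith)
    have h4 : |u| ^ (-δ) * |u| ^ (s.re - 1) ≤ BB σ δ u := by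
      rw [← Real.rpow_add h0]
      exact rpow_le_sum (abs_nonneg u) (fun h => absurd (abs_eq_zero.mp h) hu)
        (by linarith) (by linarith)
    calc |Real.log (|u|)| * ‖KK k s u‖ ≤ ((|u| ^ δ + |u| ^ (-δ)) / δ) * |u| ^ (s.re - 1) := by
          gcongr
      _ = (|u| ^ δ * |u| ^ (s.re - 1) + |u| ^ (-δ) * |u| ^ (s.re - 1)) / δ := by ring
      _ ≤ (BB σ δ u + BB σ δ u) / δ := by gcongr
      _ = _ := by ring

lemma integrable_BB {c σ δ : ℝ} (hc : 0 < c) (hδ : 0 < δ) (hσ : 2 * δ < σ) :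
    Integrable (fun u : ℝ => BB σ δ u * Real.exp (-c * |u|)) := by
  have h1 := integrable_kernel (σ := σ - 2 * δ) hc (by linarith)
  have h2 := integrable_kernel (σ := σ + 2 * δ) hc (by linarith)
  refine (h1.add h2).congr (Filter.Eventually.of_forall fun u => ?_)
  simp only [BB, Pi.add_apply]; ring

/-- exponential decay -/
def Dec {r : ℕ} (f : (Fin r → ℝ) → ℂ) : Prop :=
  ∃ C c : ℝ, 0 ≤ C ∧ 0 < c ∧ ∀ t, ‖f t‖ ≤ C * ∏ ν, Real.exp (-c * |t ν|)

/-- the integral -/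
def II {r : ℕ} (f : (Fin r → ℝ) → ℂ) (k : Fin r → ℕ) (s : Fin r → ℂ) : ℂ :=
  ∫ t : Fin r → ℝ, f t * ∏ ν, KK (k ν) (s ν) (t ν)

lemma prodKK_measurable {r : ℕ} (k : Fin r → ℕ) (s : Fin r → ℂ) :
    Measurable (fun t : Fin r → ℝ => ∏ ν, KK (k ν) (s ν) (t ν)) :=
  Finset.measurable_prod _ fun ν _ => (KK_measurable _ _).comp (measurable_pi_apply ν)

lemma II_integrable {r : ℕ} {f : (Fin r → ℝ) → ℂ} (hf : Continuous f) (hd : Dec f)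
    (k : Fin r → ℕ) (s : Fin r → ℂ) (hs : ∀ ν, 0 < (s ν).re) :
    Integrable (fun t : Fin r → ℝ => f t * ∏ ν, KK (k ν) (s ν) (t ν)) := by
  obtain ⟨C, c, hC, hc, hb⟩ := hd
  have h1 : Integrable (fun t : Fin r → ℝ =>
      ∏ ν, (|t ν| ^ ((s ν).re - 1) * Real.exp (-c * |t ν|))) :=
    Integrable.fintype_prod (f := fun ν (u : ℝ) => |u| ^ ((s ν).re - 1) * Real.exp (-c * |u|))
      fun ν => integrable_kernel hc (hs ν)
  refine (h1.const_mul C).mono' (hf.aestronglyMeasurable.mul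
    (prodKK_measurable k s).aestronglyMeasurable) (Filter.Eventually.of_forall fun t => ?_)
  rw [norm_mul, norm_prod, Finset.prod_mul_distrib]
  calc ‖f t‖ * ∏ ν, ‖KK (k ν) (s ν) (t ν)‖
      ≤ (C * ∏ ν, Real.exp (-c * |t ν|)) * ∏ ν, |t ν| ^ ((s ν).re - 1) := by
        gcongr with ν
        · exact hb t
        · exact KK_norm_le _ _ _
    _ = _ := by ring

lemma II_differentiableAt {r : ℕ} {f : (Fin r → ℝ) → ℂ} (hf : Continuous f) (hd : Dec f)
    (k : Fin r → ℕ) (s : Fin r → ℂ) (hs : ∀ ν, 0 < (s ν).re) :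
    DifferentiableAt ℂ (II f k) s := by
  have hI := II_integrable hf hd k s hs
  obtain ⟨C, c, hC, hc, hb⟩ := hd
  obtain ⟨δ, hδ, hδs⟩ : ∃ δ : ℝ, 0 < δ ∧ ∀ ν, 2 * δ < (s ν).re := by
    have : ∀ᶠ δ : ℝ in nhdsWithin 0 (Set.Ioi 0), ∀ ν, 2 * δ < (s ν).re := by
      rw [Filter.eventually_all]
      intro ν
      apply Filter.Eventually.filter_mono nhdsWithin_le_nhds
      have : Filter.Tendsto (fun δ : ℝ => 2 * δ) (nhds 0) (nhds (2 * 0)) :=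
        (continuous_const.mul continuous_id).tendsto 0
      exact this.eventually (gt_mem_nhds (by simpa using hs ν))
    obtain ⟨δ, h1, h2⟩ := (this.and self_mem_nhdsWithin).exists
    exact ⟨δ, h2, h1⟩
  have hre : ∀ z ∈ Metric.ball s δ, ∀ ν, |(z ν).re - (s ν).re| ≤ δ := by
    intro z hz ν
    rw [← Complex.sub_re]
    refine (Complex.abs_re_le_norm _).trans ?_
    rw [mem_ball_iff_norm] at hz
    exact (norm_le_pi_norm (z - s) ν).trans hz.le
  let F' : (Fin r → ℂ) → (Fin r → ℝ) → ((Fin r → ℂ) →L[ℂ] ℂ) := fun z t =>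
    f t • ∑ ν, (∏ μ ∈ Finset.univ.erase ν, KK (k μ) (z μ) (t μ)) •
      (((Real.log (t ν) : ℂ) * KK (k ν) (z ν) (t ν)) •
        (ContinuousLinearMap.proj (R := ℂ) (φ := fun _ : Fin r => ℂ) ν))
  have hball : Integrable (fun t : Fin r → ℝ =>
      ∏ ν, (BB (s ν).re δ (t ν) * Real.exp (-c * |t ν|))) :=
    Integrable.fintype_prod (f := fun ν (u : ℝ) => BB (s ν).re δ u * Real.exp (-c * |u|))
      fun ν => integrable_BB hc hδ (hδs ν)
  have key := hasFDerivAt_integral_of_dominated_of_fderiv_le (μ := (volume : Measure (Fin r → ℝ)))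
    (F := fun (z : Fin r → ℂ) t => f t * ∏ ν, KK (k ν) (z ν) (t ν)) (F' := F') (x₀ := s)
    (bound := fun t => (C * (r * (2 / δ))) * ∏ ν, (BB (s ν).re δ (t ν) * Real.exp (-c * |t ν|)))
    (Metric.ball_mem_nhds s hδ)
    (Filter.Eventually.of_forall fun z => hf.aestronglyMeasurable.mul
      (prodKK_measurable k z).aestronglyMeasurable) hI ?_ ?_ (hball.const_mul _) ?_
  · exact key.differentiableAt
  · refine AEStronglyMeasurable.smul hf.aestronglyMeasurable ?_
    refine Finset.aestronglyMeasurable_fun_sum _ fun ν _ => ?_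
    have h0 : AEStronglyMeasurable (fun t : Fin r → ℝ =>
        ∏ μ ∈ Finset.univ.erase ν, KK (k μ) (s μ) (t μ)) volume :=
      (Finset.measurable_prod _ fun ν _ =>
        (KK_measurable _ _).comp (measurable_pi_apply ν)).aestronglyMeasurable
    have h1 : Measurable (fun t : Fin r → ℝ => KK (k ν) (s ν) (t ν)) :=
      (KK_measurable _ _).comp (measurable_pi_apply ν)
    have h2 : Measurable (fun t : Fin r → ℝ => ((Real.log (t ν) : ℝ) : ℂ)) := by fun_prop
    exact h0.smul ((h2.mul h1).aestronglyMeasurable.smul_const _)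
  · refine Filter.Eventually.of_forall fun t z hz => ?_
    have hterm : ∀ ν, ‖(∏ μ ∈ Finset.univ.erase ν, KK (k μ) (z μ) (t μ)) •
      (((Real.log (t ν) : ℂ) * KK (k ν) (z ν) (t ν)) •
        (ContinuousLinearMap.proj (R := ℂ) (φ := fun _ : Fin r => ℂ) ν))‖ ≤
        2 / δ * ∏ μ, BB (s μ).re δ (t μ) := by
      intro ν
      rw [norm_smul, norm_smul, norm_prod]
      have hp : ‖ContinuousLinearMap.proj (R := ℂ) (φ := fun _ : Fin r => ℂ) ν‖ ≤ 1 := by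
        refine ContinuousLinearMap.opNorm_le_bound _ zero_le_one fun v => ?_
        rw [one_mul]; exact norm_le_pi_norm v ν
      have h1 := logKK_le_BB (k ν) hδ (hre z hz ν) (t ν)
      have hB := fun μ => BB_nonneg (s μ).re δ (t μ)
      have h2 : ∏ μ ∈ Finset.univ.erase ν, ‖KK (k μ) (z μ) (t μ)‖ ≤
          ∏ μ ∈ Finset.univ.erase ν, BB (s μ).re δ (t μ) :=
        Finset.prod_le_prod (fun _ _ => norm_nonneg _) fun μ _ => KK_le_BB _ hδ (hre z hz μ) _
      rw [← Finset.prod_erase_mul Finset.univ _ (Finset.mem_univ ν)]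
      calc _ ≤ (∏ μ ∈ Finset.univ.erase ν, BB (s μ).re δ (t μ)) *
            ((2 / δ * BB (s ν).re δ (t ν)) * 1) := by
              have h3 : 0 ≤ ∏ μ ∈ Finset.univ.erase ν, BB (s μ).re δ (t μ) :=
                Finset.prod_nonneg fun μ _ => hB μ
              have := hB ν
              gcongr
        _ = _ := by ring
    rw [norm_smul, Finset.prod_mul_distrib]
    calc _ ≤ (C * ∏ ν, Real.exp (-c * |t ν|)) * (∑ ν : Fin r, 2 / δ * ∏ μ, BB (s μ).re δ (t μ)) := by
          gcongr
          · exact hb t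
          · exact (norm_sum_le _ _).trans (Finset.sum_le_sum fun ν _ => hterm ν)
      _ = _ := by
          simp only [Finset.sum_const, Finset.card_univ, Fintype.card_fin, nsmul_eq_mul]; ring
  · refine Filter.Eventually.of_forall fun t z hz => ?_
    refine HasFDerivAt.const_mul ?_ (f t)
    refine HasFDerivAt.finsetProd fun ν _ => ?_
    have h1 := KK_hasDerivAt_s (k ν) (z ν) (t ν)
    have h2 : HasFDerivAt (fun z : Fin r → ℂ => z ν)
      (ContinuousLinearMap.proj (R := ℂ) (φ := fun _ : Fin r => ℂ) ν) z :=
      (ContinuousLinearMap.proj (R := ℂ) (φ := fun _ : Fin r => ℂ) ν).hasFDerivAt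
    exact h1.comp_hasFDerivAt z h2

/-- primitive kernel -/
def LL (k : ℕ) (s : ℂ) (u : ℝ) : ℂ := ((Real.sign u : ℂ)) ^ k * ((|u| : ℝ) : ℂ) ^ s

lemma KK_succ (k : ℕ) (s : ℂ) {u : ℝ} (hu : u ≠ 0) : KK (k + 1) (s + 1) u = LL k s u := by
  have hu' : (u : ℂ) ≠ 0 := by exact_mod_cast hu
  have h0 : ((|u| : ℝ) : ℂ) ≠ 0 := by simpa using hu
  have h1 : (Real.sign u : ℂ) * ((|u| : ℝ) : ℂ) = (u : ℂ) := by
    rcases lt_or_gt_of_ne hu with h | h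
    · rw [Real.sign_of_neg h, abs_of_neg h]; push_cast; ring
    · rw [Real.sign_of_pos h, abs_of_pos h]; push_cast; ring
  unfold KK LL
  rw [Complex.cpow_add _ _ h0, Complex.cpow_one, pow_succ]
  calc _ = ((Real.sign u : ℂ)) ^ k * ((|u| : ℝ) : ℂ) ^ s *
        (((Real.sign u : ℂ) * ((|u| : ℝ) : ℂ)) * (u : ℂ)⁻¹) := by ring
    _ = _ := by rw [h1, mul_inv_cancel₀ hu', mul_one]

lemma LL_norm_le (k : ℕ) {s : ℂ} (hs : 0 < s.re) (u : ℝ) : ‖LL k s u‖ ≤ |u| ^ s.re := by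
  by_cases hu : u = 0
  · subst hu
    have : s ≠ 0 := by rintro rfl; simp at hs
    simp [LL, Complex.zero_cpow this, Real.zero_rpow hs.ne']
  · have h0 : 0 < |u| := abs_pos.mpr hu
    unfold LL
    rw [norm_mul, Complex.norm_cpow_eq_rpow_re_of_pos h0]
    exact mul_le_of_le_one_left (by positivity) (norm_sign_pow_le k u)

lemma LL_zero (k : ℕ) {s : ℂ} (hs : 0 < s.re) : LL k s 0 = 0 := by
  have := LL_norm_le k hs 0
  rw [abs_zero, Real.zero_rpow hs.ne'] at this
  exact norm_le_zero_iff.mp this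

lemma sign_eventuallyEq {u : ℝ} (hu : u ≠ 0) : ∀ᶠ v in nhds u, Real.sign v = Real.sign u := by
  rcases lt_or_gt_of_ne hu with h | h
  · filter_upwards [Iio_mem_nhds h] with v hv
    rw [Real.sign_of_neg h, Real.sign_of_neg hv]
  · filter_upwards [Ioi_mem_nhds h] with v hv
    rw [Real.sign_of_pos h, Real.sign_of_pos hv]

lemma LL_hasDerivAt (k : ℕ) (s : ℂ) {u : ℝ} (hu : u ≠ 0) :
    HasDerivAt (LL k s) (s * KK k s u) u := by
  have h1 : HasDerivAt (fun v : ℝ => ((Real.sign u : ℂ)) ^ k *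
      Complex.exp ((Real.log v : ℂ) * s)) (((Real.sign u : ℂ)) ^ k *
      (Complex.exp ((Real.log u : ℂ) * s) * (((u⁻¹ : ℝ) : ℂ) * s))) u :=
    (((Real.hasDerivAt_log hu).ofReal_comp.mul_const s).cexp).const_mul _
  have h2 : LL k s =ᶠ[nhds u] (fun v : ℝ => ((Real.sign u : ℂ)) ^ k *
      Complex.exp ((Real.log v : ℂ) * s)) := by
    filter_upwards [sign_eventuallyEq hu, isOpen_ne.mem_nhds hu] with v hv hv'
    rw [LL, hv, abs_cpow_eq hv']
  refine (h1.congr_of_eventuallyEq h2).congr_deriv ?_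
  rw [KK, abs_cpow_eq hu]
  push_cast
  ring

lemma ibp1 {g g' : ℝ → ℂ} (hg : ∀ u, HasDerivAt g (-(g' u)) u) (hg' : Continuous g')
    {C c : ℝ} (hc : 0 < c) (hb : ∀ u, ‖g u‖ ≤ C * Real.exp (-c * |u|))
    {C' c' : ℝ} (hc' : 0 < c') (hb' : ∀ u, ‖g' u‖ ≤ C' * Real.exp (-c' * |u|))
    (k : ℕ) {s : ℂ} (hs : 0 < s.re) :
    s * ∫ u, g u * KK k s u = ∫ u, g' u * KK (k + 1) (s + 1) u := by
  have hgc : Continuous g := continuous_iff_continuousAt.mpr fun u => (hg u).continuousAt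
  have hkint : ∀ {h : ℝ → ℂ} {C c : ℝ} (_ : Continuous h) (_ : 0 < c)
      (_ : ∀ u, ‖h u‖ ≤ C * Real.exp (-c * |u|)) (k : ℕ) {s : ℂ} (_ : 0 < s.re),
      Integrable (fun u => h u * KK k s u) := by
    intro h C c h1 h2 h3 k s hs
    refine ((integrable_kernel h2 hs).const_mul C).mono' (h1.aestronglyMeasurable.mul
      (KK_measurable k s).aestronglyMeasurable) (Filter.Eventually.of_forall fun u => ?_)
    rw [norm_mul]
    calc _ ≤ (C * Real.exp (-c * |u|)) * |u| ^ (s.re - 1) := by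
          gcongr
          · exact (norm_nonneg _).trans (h3 u)
          · exact h3 u
          · exact KK_norm_le _ _ _
      _ = _ := by ring
  have i1 : Integrable (fun u => g u * KK k s u) := hkint hgc hc hb k hs
  have i2 : Integrable (fun u => g' u * KK (k + 1) (s + 1) u) :=
    hkint hg' hc' hb' (k + 1) (by simp; linarith)
  have i3 : Integrable (fun u => s * (g u * KK k s u) - g' u * KK (k + 1) (s + 1) u) :=
    (i1.const_mul s).sub i2
  have hder : ∀ u ≠ 0, HasDerivAt (fun u => g u * LL k s u)
      (s * (g u * KK k s u) - g' u * KK (k + 1) (s + 1) u) u := by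
    intro u hu
    refine ((hg u).mul (LL_hasDerivAt k s hu)).congr_deriv ?_
    rw [KK_succ k s hu]; ring
  have hH : ∀ u, ‖g u * LL k s u‖ ≤ C * (|u| ^ s.re * Real.exp (-c * |u|)) := by
    intro u
    rw [norm_mul]
    calc _ ≤ (C * Real.exp (-c * |u|)) * |u| ^ s.re := by
          gcongr
          · exact (norm_nonneg _).trans (hb u)
          · exact hb u
          · exact LL_norm_le _ hs _
      _ = _ := by ring
  have hcont : ContinuousAt (fun u => g u * LL k s u) 0 := by
    unfold ContinuousAt
    beta_reduce
    rw [LL_zero k hs, mul_zero]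
    refine squeeze_zero_norm hH ?_
    have h1 : Continuous (fun u : ℝ => C * (|u| ^ s.re * Real.exp (-c * |u|))) :=
      continuous_const.mul ((continuous_abs.rpow_const fun _ => Or.inr hs.le).mul
        (Real.continuous_exp.comp (continuous_const.mul continuous_abs)))
    have := h1.tendsto 0
    simpa [Real.zero_rpow hs.ne'] using this
  have hlim : Filter.Tendsto (fun a : ℝ => C * (a ^ s.re * Real.exp (-c * a)))
      Filter.atTop (nhds 0) := by
    simpa using (tendsto_rpow_mul_exp_neg_mul_atTop_nhds_zero s.re c hc).const_mul C
  have e1 := integral_Ioi_of_hasDerivAt_of_tendsto hcont.continuousWithinAt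
    (fun u hu => hder u (ne_of_gt hu)) i3.integrableOn
    (squeeze_zero_norm hH (hlim.comp Filter.tendsto_abs_atTop_atTop))
  have e2 := integral_Iic_of_hasDerivAt_of_tendsto hcont.continuousWithinAt
    (fun u hu => hder u (ne_of_lt hu)) i3.integrableOn
    (squeeze_zero_norm hH (hlim.comp Filter.tendsto_abs_atBot_atTop))
  have e3 := intervalIntegral.integral_Iic_add_Ioi (b := 0) i3.integrableOn i3.integrableOn
  rw [e1, e2, integral_sub (i1.const_mul s) i2, integral_const_mul] at e3
  rw [← sub_eq_zero, ← e3]; ring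

/-- A class of functions closed under (negated) partial derivatives. -/
def Good {r : ℕ} (S : Set ((Fin r → ℝ) → ℂ)) : Prop :=
  ∀ f ∈ S, Continuous f ∧ Dec f ∧ ∀ ν, ∃ f' ∈ S, ∀ t : Fin r → ℝ,
    HasDerivAt (fun u => f (Function.update t ν u)) (-(f' t)) (t ν)

lemma II_fubini {n : ℕ} {f : (Fin (n + 1) → ℝ) → ℂ} (hf : Continuous f) (hd : Dec f)
    (k : Fin (n + 1) → ℕ) (s : Fin (n + 1) → ℂ) (hs : ∀ ν, 0 < (s ν).re) (ν : Fin (n + 1)) :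
    II f k s = ∫ t' : Fin n → ℝ, (∏ j, KK (k (ν.succAbove j)) (s (ν.succAbove j)) (t' j)) *
      ∫ u : ℝ, f (ν.insertNth u t') * KK (k ν) (s ν) u := by
  have hI := II_integrable hf hd k s hs
  have mp := (volume_preserving_piFinSuccAbove (fun _ : Fin (n + 1) => ℝ) ν).symm
  rw [II, ← mp.integral_comp']
  have hI2 := mp.integrable_comp_of_integrable hI
  rw [Measure.volume_eq_prod] at hI2 ⊢
  refine (integral_prod_symm _ hI2).trans ?_
  refine integral_congr_ae (Filter.Eventually.of_forall fun t' => ?_)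
  beta_reduce
  rw [← integral_const_mul]
  refine integral_congr_ae (Filter.Eventually.of_forall fun u => ?_)
  have e : (MeasurableEquiv.piFinSuccAbove (fun _ : Fin (n + 1) => ℝ) ν).symm (u, t') =
    ν.insertNth u t' := rfl
  simp only [Function.comp_apply, e]
  rw [Fin.prod_univ_succAbove _ ν]
  simp only [Fin.insertNth_apply_same, Fin.insertNth_apply_succAbove]
  ring

lemma slice_bound {n : ℕ} {f : (Fin (n + 1) → ℝ) → ℂ} (hd : Dec f) (ν : Fin (n + 1))
    (t' : Fin n → ℝ) :
    ∃ C c : ℝ, 0 < c ∧ ∀ u : ℝ, ‖f (ν.insertNth u t')‖ ≤ C * Real.exp (-c * |u|) := by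
  obtain ⟨C, c, hC, hc, hb⟩ := hd
  refine ⟨C * ∏ j, Real.exp (-c * |t' j|), c, hc, fun u => (hb _).trans (le_of_eq ?_)⟩
  rw [Fin.prod_univ_succAbove _ ν]
  simp only [Fin.insertNth_apply_same, Fin.insertNth_apply_succAbove]
  ring

lemma ibp {r : ℕ} {S : Set ((Fin r → ℝ) → ℂ)} (hS : Good S) {f : (Fin r → ℝ) → ℂ} (hf : f ∈ S)
    (ν : Fin r) : ∃ f' ∈ S, ∀ (k : Fin r → ℕ) (s : Fin r → ℂ), (∀ ν, 0 < (s ν).re) →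
      s ν * II f k s = II f' (Function.update k ν (k ν + 1)) (Function.update s ν (s ν + 1)) := by
  obtain ⟨hc, hd, h3⟩ := hS f hf
  obtain ⟨f', hf', hder⟩ := h3 ν
  obtain ⟨hc', hd', -⟩ := hS f' hf'
  refine ⟨f', hf', fun k s hs => ?_⟩
  cases r with
  | zero => exact ν.elim0
  | succ n =>
  rw [II_fubini hc hd k s hs ν, II_fubini hc' hd' _ _ _ ν]
  · simp only [Function.update_self, Function.update_of_ne (Fin.succAbove_ne ν _)]
    rw [← integral_const_mul]
    refine integral_congr_ae (Filter.Eventually.of_forall fun t' => ?_)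
    simp only
    obtain ⟨C, c, h1, h2⟩ := slice_bound hd ν t'
    obtain ⟨C', c', h1', h2'⟩ := slice_bound hd' ν t'
    rw [mul_left_comm]
    congr 1
    refine ibp1 (fun u => ?_) ?_ h1 h2 h1' h2' (k ν) (hs ν)
    · have := hder (ν.insertNth u t')
      simpa using this
    · exact hc'.comp (by fun_prop)
  · intro μ
    by_cases h : μ = ν
    · subst h; rw [Function.update_self]; have := hs μ; simp; linarith
    · rw [Function.update_of_ne h]; exact hs μ

/-- normalised integral -/
def JJ {r : ℕ} (f : (Fin r → ℝ) → ℂ) (k : Fin r → ℕ) (s : Fin r → ℂ) : ℂ :=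
  (∏ ν, (Complex.Gamma (s ν))⁻¹) * II f k s

lemma JJ_step1 {r : ℕ} {S : Set ((Fin r → ℝ) → ℂ)} (hS : Good S) {f : (Fin r → ℝ) → ℂ}
    (hf : f ∈ S) (ν : Fin r) : ∃ f' ∈ S, ∀ (k : Fin r → ℕ) (s : Fin r → ℂ),
      (∀ ν, 0 < (s ν).re) →
      JJ f k s = JJ f' (Function.update k ν (k ν + 1)) (Function.update s ν (s ν + 1)) := by
  obtain ⟨f', hf', h⟩ := ibp hS hf ν
  refine ⟨f', hf', fun k s hs => ?_⟩
  have h0 : s ν ≠ 0 := by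
    intro h; have := hs ν; rw [h] at this; simp at this
  rw [JJ, JJ, ← h k s hs, ← Finset.mul_prod_erase Finset.univ _ (Finset.mem_univ ν),
    ← Finset.mul_prod_erase Finset.univ
      (fun μ => (Complex.Gamma (Function.update s ν (s ν + 1) μ))⁻¹) (Finset.mem_univ ν)]
  have e : ∏ μ ∈ Finset.univ.erase ν, (Complex.Gamma (Function.update s ν (s ν + 1) μ))⁻¹ =
      ∏ μ ∈ Finset.univ.erase ν, (Complex.Gamma (s μ))⁻¹ := by
    refine Finset.prod_congr rfl fun μ hμ => ?_
    rw [Function.update_of_ne (Finset.ne_of_mem_erase hμ)]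
  rw [e, Function.update_self, Complex.Gamma_add_one _ h0, mul_inv]
  field_simp

lemma JJ_stepT {r : ℕ} {S : Set ((Fin r → ℝ) → ℂ)} (hS : Good S) {f : (Fin r → ℝ) → ℂ}
    (hf : f ∈ S) (T : Finset (Fin r)) : ∃ f' ∈ S, ∀ (k : Fin r → ℕ) (s : Fin r → ℂ),
      (∀ ν, 0 < (s ν).re) →
      JJ f k s = JJ f' (fun ν => if ν ∈ T then k ν + 1 else k ν)
        (fun ν => if ν ∈ T then s ν + 1 else s ν) := by
  induction T using Finset.induction_on with
  | empty => exact ⟨f, hf, fun k s _ => by simp⟩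
  | insert ν T hν ih =>
    obtain ⟨f', hf', h⟩ := ih
    obtain ⟨f'', hf'', h'⟩ := JJ_step1 hS hf' ν
    refine ⟨f'', hf'', fun k s hs => ?_⟩
    rw [h k s hs, h']
    · congr 1
      · funext μ
        by_cases hμ : μ = ν
        · subst hμ; simp [hν]
        · simp [hμ]
      · funext μ
        by_cases hμ : μ = ν
        · subst hμ; simp [hν]
        · simp [hμ]
    · intro μ
      have := hs μ
      by_cases hμ : μ ∈ T
      · simp [hμ]; linarith
      · simpa [hμ]

lemma JJ_step {r : ℕ} {S : Set ((Fin r → ℝ) → ℂ)} (hS : Good S) (f : S) :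
    ∃ f' : S, ∀ (k : Fin r → ℕ) (s : Fin r → ℂ),
      (∀ ν, 0 < (s ν).re) →
      JJ f k s = JJ f' (fun ν => k ν + 1) (fun ν => s ν + 1) := by
  obtain ⟨f', hf', h⟩ := JJ_stepT hS f.2 Finset.univ
  exact ⟨⟨f', hf'⟩, by simpa using h⟩

lemma differentiableAt_prod' {r : ℕ} {g : Fin r → (Fin r → ℂ) → ℂ} {s : Fin r → ℂ}
    (h : ∀ ν, DifferentiableAt ℂ (g ν) s) : DifferentiableAt ℂ (fun s => ∏ ν, g ν s) s :=
  (HasFDerivAt.finsetProd (u := Finset.univ) fun ν _ => (h ν).hasFDerivAt).differentiableAt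

lemma JJ_differentiableAt {r : ℕ} {f : (Fin r → ℝ) → ℂ} (hf : Continuous f) (hd : Dec f)
    (k : Fin r → ℕ) (s : Fin r → ℂ) (hs : ∀ ν, 0 < (s ν).re) :
    DifferentiableAt ℂ (JJ f k) s := by
  refine DifferentiableAt.mul ?_ (II_differentiableAt hf hd k s hs)
  refine differentiableAt_prod' fun ν => ?_
  exact DifferentiableAt.comp (f := fun s : Fin r → ℂ => s ν) s
    (Complex.differentiable_one_div_Gamma (s ν)) (differentiableAt_apply ν s)

lemma JJ_extend {r : ℕ} {S : Set ((Fin r → ℝ) → ℂ)} (hS : Good S) (f : S) (k : Fin r → ℕ) :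
    ∃ G : (Fin r → ℂ) → ℂ, Differentiable ℂ G ∧
      ∀ s : Fin r → ℂ, (∀ ν, 0 < (s ν).re) → G s = JJ f k s := by
  choose D hD using JJ_step hS
  let fN : ℕ → S := fun N => D^[N] f
  let G : ℕ → (Fin r → ℂ) → ℂ := fun N s => JJ (fN N) (fun ν => k ν + N) (fun ν => s ν + N)
  have hstep : ∀ (N : ℕ) (s : Fin r → ℂ), (∀ ν, -(N : ℝ) < (s ν).re) → G N s = G (N + 1) s := by
    intro N s hs
    have h1 := hD (fN N) (fun ν => k ν + N) (fun ν => s ν + N)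
      (fun ν => by have := hs ν; simp; linarith)
    have h2 : fN (N + 1) = D (fN N) := Function.iterate_succ_apply' D N f
    simp only [G]
    rw [h1, h2]
    congr 1
    funext ν; push_cast; ring
  have hmono : ∀ (N j : ℕ) (s : Fin r → ℂ), (∀ ν, -(N : ℝ) < (s ν).re) → G N s = G (N + j) s := by
    intro N j s hs
    induction j with
    | zero => rfl
    | succ j ih =>
      rw [ih, ← add_assoc]
      refine hstep _ _ fun ν => ?_
      have := hs ν
      push_cast
      have : (0 : ℝ) ≤ j := j.cast_nonneg
      linarith
  have hdiff : ∀ (N : ℕ) (s : Fin r → ℂ), (∀ ν, -(N : ℝ) < (s ν).re) → DifferentiableAt ℂ (G N) s := by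
    intro N s hs
    obtain ⟨hc, hd, -⟩ := hS _ (fN N).2
    have h1 := JJ_differentiableAt hc hd (fun ν => k ν + N) (fun ν => s ν + N)
      (fun ν => by have := hs ν; simp; linarith)
    have h2 : DifferentiableAt ℂ (fun (s : Fin r → ℂ) (ν : Fin r) => s ν + (N : ℂ)) s := by
      fun_prop
    exact DifferentiableAt.comp s (f := fun (s : Fin r → ℂ) (ν : Fin r) => s ν + (N : ℂ)) h1 h2
  have hnorm : ∀ (s : Fin r → ℂ) (N : ℕ), ‖s‖ < N → ∀ ν, -(N : ℝ) < (s ν).re := by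
    intro s N h ν
    have h1 := (Complex.abs_re_le_norm (s ν)).trans (norm_le_pi_norm s ν)
    have := (abs_le.mp h1).1
    linarith
  let n : (Fin r → ℂ) → ℕ := fun s => ⌊‖s‖⌋₊ + 1
  have hn : ∀ s, ‖s‖ < n s := fun s => by
    have := Nat.lt_floor_add_one ‖s‖
    simpa [n] using this
  have hany : ∀ (s : Fin r → ℂ) (N : ℕ), (∀ ν, -(N : ℝ) < (s ν).re) → G (n s) s = G N s := by
    intro s N h
    rw [hmono N (n s) s h, hmono (n s) N s (hnorm s _ (hn s)), add_comm]
  refine ⟨fun s => G (n s) s, fun s => ?_, fun s hs => ?_⟩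
  · have hd := hdiff (n s) s (hnorm s _ (hn s))
    refine hd.congr_of_eventuallyEq ?_
    have : ∀ᶠ z in nhds s, ‖z‖ < n s := continuous_norm.continuousAt.eventually_lt
      continuousAt_const (hn s)
    filter_upwards [this] with z hz
    exact hany z _ (hnorm z _ hz)
  · have := hany s 0 (by simpa using hs)
    simp only [this, G, fN]
    simp

/-- `W = 1 / (1 - e(y + it))` -/
def WW (y t : ℝ) : ℂ := (1 - eC (y + Complex.I * t))⁻¹

/-- one-dimensional class closed under derivatives -/
def gg (x y : ℝ) (Q : Polynomial ℂ) (t : ℝ) : ℂ := eC (Complex.I * t * x) * WW y t * Q.eval (WW y t)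

lemma eC_decomp (y t : ℝ) : eC (y + Complex.I * t) =
    ((Real.exp (-(2 * Real.pi * t)) : ℝ) : ℂ) *
      (Real.cos (2 * Real.pi * y) + Real.sin (2 * Real.pi * y) * Complex.I) := by
  unfold eC
  push_cast
  rw [← Complex.exp_mul_I, ← Complex.exp_add]
  congr 1
  linear_combination (2 * Real.pi * t : ℂ) * Complex.I_sq

lemma cos_lt_one' {y : ℝ} (hy : y ∈ Set.Ioo (0 : ℝ) 1) : Real.cos (2 * Real.pi * y) < 1 := by
  refine lt_of_le_of_ne (Real.cos_le_one _) fun h => ?_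
  have hp := Real.pi_pos
  have := (Real.cos_eq_one_iff_of_lt_of_lt (by nlinarith [hy.1]) (by nlinarith [hy.2])).mp h
  nlinarith [hy.1]

lemma normSq_lower {y : ℝ} (t : ℝ) : (1 - Real.cos (2 * Real.pi * y)) / 2 *
      (1 + Real.exp (-(2 * Real.pi * t)) ^ 2) ≤ ‖1 - eC (y + Complex.I * t)‖ ^ 2 := by
  rw [eC_decomp, ← Complex.normSq_eq_norm_sq, Complex.normSq_apply]
  set a := Real.exp (-(2 * Real.pi * t))
  have ha : 0 < a := Real.exp_pos _
  have h1 := Real.sin_sq_add_cos_sq (2 * Real.pi * y)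
  have h2 := Real.cos_le_one (2 * Real.pi * y)
  have h3 := Real.neg_one_le_cos (2 * Real.pi * y)
  set c := Real.cos (2 * Real.pi * y)
  set d := Real.sin (2 * Real.pi * y)
  simp only [Complex.sub_re, Complex.sub_im, Complex.mul_re, Complex.mul_im, Complex.add_re,
    Complex.add_im, Complex.ofReal_re, Complex.ofReal_im, Complex.I_re, Complex.I_im,
    Complex.one_re, Complex.one_im]
  have h4 : 0 ≤ (1 + c) * (1 - a) ^ 2 := by
    have : 0 ≤ 1 + c := by linarith
    positivity
  have h5 : 0 ≤ (1 - c) * a := by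
    have : 0 ≤ 1 - c := by linarith
    positivity
  nlinarith

lemma norm_lower {y : ℝ} (hy : y ∈ Set.Ioo (0 : ℝ) 1) : ∃ m : ℝ, 0 < m ∧ ∀ t : ℝ,
    m ≤ ‖1 - eC (y + Complex.I * t)‖ ∧
      m * Real.exp (-(2 * Real.pi * t)) ≤ ‖1 - eC (y + Complex.I * t)‖ := by
  have h := cos_lt_one' hy
  set p := (1 - Real.cos (2 * Real.pi * y)) / 2 with hp
  have hp0 : 0 < p := by rw [hp]; linarith
  refine ⟨Real.sqrt p, Real.sqrt_pos.mpr hp0, fun t => ?_⟩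
  have h1 := normSq_lower (y := y) t
  rw [← hp] at h1
  have h2 := Real.sq_sqrt hp0.le
  have he := Real.exp_pos (-(2 * Real.pi * t))
  constructor
  · refine le_of_sq_le_sq ?_ (norm_nonneg _)
    rw [h2]; nlinarith [mul_nonneg hp0.le (sq_nonneg (Real.exp (-(2 * Real.pi * t))))]
  · refine le_of_sq_le_sq ?_ (norm_nonneg _)
    rw [mul_pow, h2]; nlinarith

lemma D_ne_zero {y : ℝ} (hy : y ∈ Set.Ioo (0 : ℝ) 1) (t : ℝ) :
    1 - eC (y + Complex.I * t) ≠ 0 := by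
  obtain ⟨m, hm, h⟩ := norm_lower hy
  exact norm_pos_iff.mp (hm.trans_le (h t).1)

lemma hasDerivAt_eC_lin (a b : ℂ) (t : ℝ) :
    HasDerivAt (fun t : ℝ => eC (a + b * t)) (2 * Real.pi * Complex.I * b * eC (a + b * t)) t := by
  unfold eC
  have h1 : HasDerivAt (fun t : ℝ => 2 * Real.pi * Complex.I * (a + b * (t : ℂ)))
      (2 * Real.pi * Complex.I * (b * 1)) t :=
    (((Complex.ofRealCLM.hasDerivAt (x := t)).const_mul b).const_add a).const_mul _
  exact h1.cexp.congr_deriv (by ring)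

lemma WW_hasDerivAt {y : ℝ} (hy : y ∈ Set.Ioo (0 : ℝ) 1) (t : ℝ) :
    HasDerivAt (WW y) (-(2 * Real.pi) * (WW y t ^ 2 - WW y t)) t := by
  have h0 := D_ne_zero hy t
  have h1 := ((hasDerivAt_eC_lin y Complex.I t).const_sub 1).inv h0
  refine h1.congr_deriv ?_
  unfold WW
  field_simp
  linear_combination eC (y + Complex.I * t) * Complex.I_sq

lemma gg_hasDerivAt (x : ℝ) {y : ℝ} (hy : y ∈ Set.Ioo (0 : ℝ) 1) (Q : Polynomial ℂ) :
    ∃ Q' : Polynomial ℂ, ∀ t, HasDerivAt (gg x y Q) (gg x y Q' t) t := by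
  refine ⟨Polynomial.C (-(2 * Real.pi * x) : ℂ) * Q
    - Polynomial.C (2 * Real.pi : ℂ) * (Polynomial.X - 1) * Q
    - Polynomial.C (2 * Real.pi : ℂ) * (Polynomial.X ^ 2 - Polynomial.X) * Q.derivative,
    fun t => ?_⟩
  have h1 : HasDerivAt (fun t : ℝ => eC (Complex.I * t * x))
      (-(2 * Real.pi * x) * eC (Complex.I * t * x)) t := by
    have := hasDerivAt_eC_lin 0 (Complex.I * x) t
    simp only [zero_add] at this
    have e : ∀ t : ℝ, Complex.I * (t : ℂ) * x = Complex.I * x * t := fun t => by ring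
    simp only [e]
    refine this.congr_deriv ?_
    linear_combination (2 * Real.pi * x * eC (Complex.I * x * t)) * Complex.I_sq
  have h2 := WW_hasDerivAt hy t
  have h3 : HasDerivAt (fun t => Q.eval (WW y t))
      (Q.derivative.eval (WW y t) * (-(2 * Real.pi) * (WW y t ^ 2 - WW y t))) t :=
    (Q.hasDerivAt (WW y t)).comp t h2
  refine ((h1.mul h2).mul h3).congr_deriv ?_
  simp only [gg, Pi.mul_apply, Polynomial.eval_sub, Polynomial.eval_mul, Polynomial.eval_C, Polynomial.eval_X,
    Polynomial.eval_pow, Polynomial.eval_one]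
  ring

lemma poly_bound (Q : Polynomial ℂ) (M : ℝ) : ∃ C : ℝ, 0 ≤ C ∧ ∀ z : ℂ, ‖z‖ ≤ M → ‖Q.eval z‖ ≤ C := by
  obtain ⟨C, hC⟩ := (isCompact_closedBall (0 : ℂ) M).exists_bound_of_continuousOn
    (f := fun z => Q.eval z) Q.continuous.continuousOn
  refine ⟨max C 0, le_max_right _ _, fun z hz => (hC z ?_).trans (le_max_left _ _)⟩
  simpa using hz

lemma gg_bound {x y : ℝ} (hx : x ∈ Set.Ioo (0 : ℝ) 1) (hy : y ∈ Set.Ioo (0 : ℝ) 1)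
    (Q : Polynomial ℂ) : ∃ C c : ℝ, 0 ≤ C ∧ 0 < c ∧ ∀ t, ‖gg x y Q t‖ ≤ C * Real.exp (-c * |t|) := by
  obtain ⟨m, hm, h⟩ := norm_lower hy
  obtain ⟨C, hC, hQ⟩ := poly_bound Q m⁻¹
  have hp := Real.pi_pos
  have hx1 : 0 < 1 - x := by linarith [hx.2]
  have hmin : 0 < min x (1 - x) := lt_min hx.1 hx1
  refine ⟨m⁻¹ * C, 2 * Real.pi * min x (1 - x), by positivity, by positivity, fun t => ?_⟩
  have hW : ‖WW y t‖ ≤ m⁻¹ := by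
    rw [WW, norm_inv]; exact inv_anti₀ hm (h t).1
  have hW2 : ‖WW y t‖ ≤ m⁻¹ * Real.exp (2 * Real.pi * t) := by
    rw [WW, norm_inv]
    refine (inv_anti₀ (by positivity) (h t).2).trans (le_of_eq ?_)
    rw [mul_inv, Real.exp_neg, inv_inv]
  have hE : ‖eC (Complex.I * t * x)‖ = Real.exp (-(2 * Real.pi * x * t)) := by
    rw [eC, Complex.norm_exp]
    congr 1
    have : 2 * (Real.pi : ℂ) * Complex.I * (Complex.I * t * x) =
        ((-(2 * Real.pi * x * t) : ℝ) : ℂ) := by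
      push_cast
      linear_combination (2 * Real.pi * t * x : ℂ) * Complex.I_sq
    rw [this, Complex.ofReal_re]
  have key : ‖eC (Complex.I * t * x)‖ * ‖WW y t‖ ≤
      m⁻¹ * Real.exp (-(2 * Real.pi * min x (1 - x)) * |t|) := by
    rw [hE]
    rcases le_total 0 t with ht | ht
    · calc _ ≤ Real.exp (-(2 * Real.pi * x * t)) * m⁻¹ := by gcongr
        _ = m⁻¹ * Real.exp (-(2 * Real.pi * x * t)) := by ring
        _ ≤ _ := by
          rw [abs_of_nonneg ht]
          have := mul_le_mul_of_nonneg_right (min_le_left x (1 - x)) ht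
          gcongr
          nlinarith
    · calc _ ≤ Real.exp (-(2 * Real.pi * x * t)) * (m⁻¹ * Real.exp (2 * Real.pi * t)) := by gcongr
        _ = m⁻¹ * Real.exp (-(2 * Real.pi * x * t) + 2 * Real.pi * t) := by
          rw [Real.exp_add]; ring
        _ ≤ _ := by
          rw [abs_of_nonpos ht]
          have := mul_le_mul_of_nonneg_right (min_le_right x (1 - x)) (neg_nonneg.mpr ht)
          gcongr
          nlinarith
  rw [gg, norm_mul, norm_mul]
  calc _ ≤ (m⁻¹ * Real.exp (-(2 * Real.pi * min x (1 - x)) * |t|)) * C := by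
        gcongr
        exact hQ _ hW
    _ = _ := by ring

/-- generators -/
def gen {r : ℕ} (A : Matrix (Fin r) (Fin r) ℝ) (x y : Fin r → ℝ) (Q : Fin r → Polynomial ℂ)
    (t : Fin r → ℝ) : ℂ := ∏ μ, gg (x μ) (y μ) (Q μ) (Matrix.vecMul t A μ)

/-- the class of functions -/
def SS {r : ℕ} (A : Matrix (Fin r) (Fin r) ℝ) (x y : Fin r → ℝ) :
    Submodule ℂ ((Fin r → ℝ) → ℂ) := Submodule.span ℂ (Set.range (gen A x y))

lemma sum_lower {r : ℕ} {A : Matrix (Fin r) (Fin r) ℝ} (hA : A.det ≠ 0) :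
    ∃ K : ℝ, 0 < K ∧ ∀ t : Fin r → ℝ, ∑ ν, |t ν| ≤ K * ∑ μ, |Matrix.vecMul t A μ| := by
  refine ⟨1 + ∑ ν, ∑ μ, |A⁻¹ μ ν|, by positivity, fun t => ?_⟩
  set v := Matrix.vecMul t A with hv
  have ht : t = Matrix.vecMul v A⁻¹ := by
    rw [hv, Matrix.vecMul_vecMul, Matrix.mul_nonsing_inv _ (isUnit_iff_ne_zero.mpr hA),
      Matrix.vecMul_one]
  have h1 : ∀ ν, |t ν| ≤ (∑ μ, |A⁻¹ μ ν|) * ∑ μ, |v μ| := by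
    intro ν
    have : t ν = ∑ μ, v μ * A⁻¹ μ ν := by
      conv_lhs => rw [ht]
      rfl
    rw [this, Finset.sum_mul]
    refine (Finset.abs_sum_le_sum_abs _ _).trans (Finset.sum_le_sum fun μ _ => ?_)
    rw [abs_mul, mul_comm]
    gcongr
    exact Finset.single_le_sum (f := fun μ => |v μ|) (fun _ _ => abs_nonneg _) (Finset.mem_univ μ)
  have h2 : ∑ ν, |t ν| ≤ (∑ ν, ∑ μ, |A⁻¹ μ ν|) * ∑ μ, |v μ| := by
    rw [Finset.sum_mul]; exact Finset.sum_le_sum fun ν _ => h1 ν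
  have h3 : 0 ≤ ∑ μ, |v μ| := by positivity
  nlinarith

lemma exists_pos_le {r : ℕ} (c : Fin r → ℝ) (hc : ∀ ν, 0 < c ν) : ∃ d : ℝ, 0 < d ∧ ∀ ν, d ≤ c ν := by
  have : ∀ᶠ δ : ℝ in nhdsWithin 0 (Set.Ioi 0), ∀ ν, δ ≤ c ν := by
    rw [Filter.eventually_all]
    intro ν
    exact Filter.Eventually.filter_mono nhdsWithin_le_nhds (Iic_mem_nhds (hc ν))
  obtain ⟨δ, h1, h2⟩ := (this.and self_mem_nhdsWithin).exists
  exact ⟨δ, h2, h1⟩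

lemma gen_dec {r : ℕ} {A : Matrix (Fin r) (Fin r) ℝ} (hA : A.det ≠ 0) {x y : Fin r → ℝ}
    (hx : ∀ ν, x ν ∈ Set.Ioo (0 : ℝ) 1) (hy : ∀ ν, y ν ∈ Set.Ioo (0 : ℝ) 1)
    (Q : Fin r → Polynomial ℂ) : Dec (gen A x y Q) := by
  obtain ⟨K, hK, hKt⟩ := sum_lower hA
  choose C c hC hc hb using fun μ => gg_bound (hx μ) (hy μ) (Q μ)
  obtain ⟨d, hd, hdc⟩ := exists_pos_le c hc
  refine ⟨∏ μ, C μ, d / K, Finset.prod_nonneg fun μ _ => hC μ, by positivity, fun t => ?_⟩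
  rw [gen, norm_prod]
  calc _ ≤ ∏ μ, (C μ * Real.exp (-d * |Matrix.vecMul t A μ|)) := by
        refine Finset.prod_le_prod (fun _ _ => norm_nonneg _) fun μ _ => (hb μ _).trans ?_
        have := hC μ
        gcongr
        exact hdc μ
    _ = (∏ μ, C μ) * Real.exp (-d * ∑ μ, |Matrix.vecMul t A μ|) := by
        rw [Finset.prod_mul_distrib, ← Real.exp_sum, Finset.mul_sum]
    _ ≤ (∏ μ, C μ) * Real.exp (-(d / K) * ∑ μ, |t μ|) := by
        have h1 : 0 ≤ ∏ μ, C μ := Finset.prod_nonneg fun μ _ => hC μ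
        refine mul_le_mul_of_nonneg_left (Real.exp_le_exp.mpr ?_) h1
        have h2 := mul_le_mul_of_nonneg_left (hKt t) (div_pos hd hK).le
        have h3 : d / K * (K * ∑ μ, |Matrix.vecMul t A μ|) = d * ∑ μ, |Matrix.vecMul t A μ| := by
          field_simp
        linarith
    _ = _ := by rw [← Real.exp_sum, Finset.mul_sum]

lemma gen_continuous {r : ℕ} (A : Matrix (Fin r) (Fin r) ℝ) {x y : Fin r → ℝ}
    (hy : ∀ ν, y ν ∈ Set.Ioo (0 : ℝ) 1)
    (Q : Fin r → Polynomial ℂ) : Continuous (gen A x y Q) := by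
  refine continuous_finsetProd _ fun μ _ => ?_
  obtain ⟨Q', h⟩ := gg_hasDerivAt (x μ) (hy μ) (Q μ)
  have h1 : Continuous (gg (x μ) (y μ) (Q μ)) :=
    continuous_iff_continuousAt.mpr fun u => (h u).continuousAt
  have h2 : Continuous (fun t : Fin r → ℝ => Matrix.vecMul t A μ) :=
    (continuous_apply μ).comp (continuous_id.matrix_vecMul continuous_const)
  exact h1.comp h2

lemma gen_deriv {r : ℕ} (A : Matrix (Fin r) (Fin r) ℝ) {x y : Fin r → ℝ}
    (hy : ∀ ν, y ν ∈ Set.Ioo (0 : ℝ) 1) (Q : Fin r → Polynomial ℂ) (ν : Fin r) :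
    ∃ f' ∈ SS A x y, ∀ t : Fin r → ℝ,
      HasDerivAt (fun u => gen A x y Q (Function.update t ν u)) (-(f' t)) (t ν) := by
  choose Q' hQ' using fun μ => gg_hasDerivAt (x μ) (hy μ) (Q μ)
  refine ⟨-∑ μ, (A ν μ : ℂ) • gen A x y (Function.update Q μ (Q' μ)), ?_, fun t => ?_⟩
  · refine Submodule.neg_mem _ (Submodule.sum_mem _ fun μ _ => Submodule.smul_mem _ _ ?_)
    exact Submodule.subset_span ⟨_, rfl⟩
  · have h1 : ∀ μ, HasDerivAt (fun u => Matrix.vecMul (Function.update t ν u) A μ) (A ν μ) (t ν) := by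
      intro μ
      have h2 := hasDerivAt_pi.mp (hasDerivAt_update t ν (t ν))
      have h3 : HasDerivAt (fun u => ∑ i, Function.update t ν u i * A i μ)
          (∑ i, (Pi.single ν (1 : ℝ) : Fin r → ℝ) i * A i μ) (t ν) :=
        HasDerivAt.fun_sum fun i _ => (h2 i).mul_const _
      refine h3.congr_deriv ?_
      simp [Pi.single_apply]
    have h4 : HasDerivAt (fun u => gen A x y Q (Function.update t ν u)) _ (t ν) :=
      HasDerivAt.fun_finsetProd (u := Finset.univ) fun μ _ =>
        HasDerivAt.scomp_of_eq (t ν) (hQ' μ (Matrix.vecMul t A μ)) (h1 μ) (by simp)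
    refine h4.congr_deriv ?_
    simp only [Pi.neg_apply, neg_neg, Finset.sum_apply, Pi.smul_apply, Function.update_eq_self]
    refine Finset.sum_congr rfl fun μ _ => ?_
    rw [gen, ← Finset.mul_prod_erase Finset.univ _ (Finset.mem_univ μ), Function.update_self]
    have e : ∏ j ∈ Finset.univ.erase μ,
        gg (x j) (y j) (Function.update Q μ (Q' μ) j) (Matrix.vecMul t A j) =
        ∏ j ∈ Finset.univ.erase μ, gg (x j) (y j) (Q j) (Matrix.vecMul t A j) :=
      Finset.prod_congr rfl fun j hj => by
        rw [Function.update_of_ne (Finset.ne_of_mem_erase hj)]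
    rw [e]
    simp only [smul_eq_mul, Complex.real_smul]
    ring

lemma dec_add {r : ℕ} {f g : (Fin r → ℝ) → ℂ} (hf : Dec f) (hg : Dec g) : Dec (f + g) := by
  obtain ⟨C, c, hC, hc, hb⟩ := hf
  obtain ⟨C', c', hC', hc', hb'⟩ := hg
  refine ⟨C + C', min c c', by positivity, lt_min hc hc', fun t => ?_⟩
  rw [add_mul]
  refine (norm_add_le _ _).trans (add_le_add ((hb t).trans ?_) ((hb' t).trans ?_))
  · gcongr; exact min_le_left _ _
  · gcongr; exact min_le_right _ _

lemma SS_good {r : ℕ} {A : Matrix (Fin r) (Fin r) ℝ} (hA : A.det ≠ 0) {x y : Fin r → ℝ}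
    (hx : ∀ ν, x ν ∈ Set.Ioo (0 : ℝ) 1) (hy : ∀ ν, y ν ∈ Set.Ioo (0 : ℝ) 1) :
    Good (SS A x y : Set ((Fin r → ℝ) → ℂ)) := by
  intro f hf
  induction hf using Submodule.span_induction with
  | mem f hf =>
    obtain ⟨Q, rfl⟩ := hf
    exact ⟨gen_continuous A hy Q, gen_dec hA hx hy Q, fun ν => gen_deriv A hy Q ν⟩
  | zero =>
    refine ⟨continuous_const, ⟨0, 1, le_rfl, one_pos, fun t => by simp⟩, fun ν => ⟨0,
      Submodule.zero_mem _, fun t => ?_⟩⟩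
    simpa using hasDerivAt_const (t ν) (0 : ℂ)
  | add f g _ _ hf hg =>
    refine ⟨hf.1.add hg.1, dec_add hf.2.1 hg.2.1, fun ν => ?_⟩
    obtain ⟨f', hf', h1⟩ := hf.2.2 ν
    obtain ⟨g', hg', h2⟩ := hg.2.2 ν
    refine ⟨f' + g', Submodule.add_mem _ hf' hg', fun t => ?_⟩
    refine ((h1 t).add (h2 t)).congr_deriv ?_
    simp only [Pi.add_apply]; ring
  | smul a f _ hf =>
    refine ⟨hf.1.const_smul a, ?_, fun ν => ?_⟩
    · obtain ⟨C, c, hC, hc, hb⟩ := hf.2.1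
      refine ⟨‖a‖ * C, c, by positivity, hc, fun t => ?_⟩
      rw [Pi.smul_apply, norm_smul, mul_assoc]
      gcongr
      exact hb t
    · obtain ⟨f', hf', h1⟩ := hf.2.2 ν
      refine ⟨a • f', Submodule.smul_mem _ a hf', fun t => ?_⟩
      refine ((h1 t).const_smul a).congr_deriv ?_
      simp
theorem stmt_5 (r : ℕ) (hr : 1 ≤ r) (χ : Fin r → ℕ) (hχ : ∀ ν, χ ν ≤ 1)
    (A : Matrix (Fin r) (Fin r) ℝ) (hA : A.det ≠ 0) (x y : Fin r → ℝ)
    (hx : ∀ ν, x ν ∈ Set.Ioo (0 : ℝ) 1) (hy : ∀ ν, y ν ∈ Set.Ioo (0 : ℝ) 1) :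
    ∃ G : (Fin r → ℂ) → ℂ, Differentiable ℂ G ∧
      ∀ s : Fin r → ℂ, (∀ ν, 0 < (s ν).re) → G s = ShintaniLchi χ s A x y := by
  obtain ⟨G, hG, hGs⟩ := JJ_extend (SS_good hA hx hy)
    ⟨gen A x y (fun _ => 1), Submodule.subset_span ⟨_, rfl⟩⟩ χ
  have h2pi : (2 * (Real.pi : ℂ)) ≠ 0 := by
    simp
  refine ⟨fun s => (∏ ν, (2⁻¹ * (2 * (Real.pi : ℂ)) ^ (s ν))) * G s, ?_, fun s hs => ?_⟩
  · refine Differentiable.mul ?_ hG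
    intro s
    refine differentiableAt_prod' fun ν => ?_
    exact (((differentiableAt_apply ν s).const_cpow (Or.inl h2pi)).const_mul _)
  · simp only [hGs s hs, JJ, II, ShintaniLchi]
    rw [← mul_assoc, ← Finset.prod_mul_distrib, ← Finset.prod_inv_distrib]
    congr 1
    · refine Finset.prod_congr rfl fun ν _ => ?_
      rw [GammaC, mul_inv, mul_inv, Complex.cpow_neg, inv_inv]
    · refine integral_congr_ae (Filter.Eventually.of_forall fun t => ?_)
      simp only [qchar, FF, gen, KK, gg, phiF, WW, Polynomial.eval_one, mul_one, div_eq_mul_inv]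
      simp only [Finset.prod_mul_distrib]
      ring

end
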